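/- Let ℬ ⊆ 𝒫(n) be a simply rooted family. Then (1) for every B ∈ ℬ and 1 ≤ k ≤ n, if D_{(ℬ,k)}(B) ≠ B then every subset of D_{(ℬ,k)}(B) belongs to D_k(ℬ), and (2) for every B ∈ ℬ, |B ∖ d_ℬ(B)| ≤ 1. -/

import Mathlib

open Finset
open scoped Classical

/-- The total size `‖𝒜‖ = Σ_{A∈𝒜} |A|` of a family of finite sets. -/
def totalSize (𝒜 : Finset (Finset ℕ)) : ℕ := ∑ A ∈ 𝒜, A.card

/-- A family is union-closed if it is closed under pairwise unions. -/
def UnionClosed (𝒜 : Finset (Finset ℕ)) : Prop := ∀ A ∈ 𝒜, ∀ B ∈ 𝒜, A ∪ B ∈ 𝒜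

/-- The `k`-th finite set of positive integers in the colex order: the positive
integer `i` belongs to it iff bit `i - 1` of `k` is set. -/
def colexSet (k : ℕ) : Finset ℕ :=
  ((Finset.range (k + 1)).filter fun i => k.testBit i).image (· + 1)

/-- The initial segment `I(m)` of length `m` of the colex order on finite sets
of positive integers. -/
def colexInit (m : ℕ) : Finset (Finset ℕ) := (Finset.range m).image colexSet

/-- A family `ℬ` is simply rooted if every nonempty `B ∈ ℬ` has some `b ∈ B`
with the whole cube `[{b}, B]` contained in `ℬ`. -/
def SimplyRooted (ℬ : Finset (Finset ℕ)) : Prop :=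
  ∀ B ∈ ℬ, B.Nonempty → ∃ b ∈ B, ∀ C : Finset ℕ, {b} ⊆ C → C ⊆ B → C ∈ ℬ

/-- `B` is `ℬ`-rooted at `i`: `i ∈ B` and the cube `[{i}, B]` lies in `ℬ`. -/
def RootedAt (ℬ : Finset (Finset ℕ)) (B : Finset ℕ) (i : ℕ) : Prop :=
  i ∈ B ∧ ∀ C : Finset ℕ, {i} ⊆ C → C ⊆ B → C ∈ ℬ

/-- `ℬ_S`: the sets of `ℬ` that are `ℬ`-rooted at some element of `S`. -/
noncomputable def rootedFam (ℬ : Finset (Finset ℕ)) (S : Finset ℕ) : Finset (Finset ℕ) :=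
  ℬ.filter fun B => ∃ i ∈ S, RootedAt ℬ B i

/-- The image of a single set `B` under the down-compression of `ℬ` in
direction `i`. -/
def compressSet (ℬ : Finset (Finset ℕ)) (i : ℕ) (B : Finset ℕ) : Finset ℕ :=
  if i ∈ B ∧ B.erase i ∉ ℬ then B.erase i else B

/-- The down-compression `d_i(ℬ)` of the family `ℬ` in direction `i`. -/
def dComp (i : ℕ) (ℬ : Finset (Finset ℕ)) : Finset (Finset ℕ) :=
  ℬ.image (compressSet ℬ i)

/-- `D_k(ℬ) = d_k(⋯ d_1(ℬ) ⋯)`.  In particular `d(ℬ) = D_n(ℬ)` for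
`ℬ ⊆ 𝒫(n)`. -/
def DComp : ℕ → Finset (Finset ℕ) → Finset (Finset ℕ)
  | 0, ℬ => ℬ
  | k + 1, ℬ => dComp (k + 1) (DComp k ℬ)

/-- `D_{(ℬ,k)}(B)`: the image of the set `B` obtained by following `B` through
the successive compressions `d_1, …, d_k`.  In particular `d_ℬ(B) = D_{(ℬ,n)}(B)`
for `ℬ ⊆ 𝒫(n)`. -/
def DCompSet : ℕ → Finset (Finset ℕ) → Finset ℕ → Finset ℕ
  | 0, _, B => B
  | k + 1, ℬ, B => compressSet (DComp k ℬ) (k + 1) (DCompSet k ℬ B)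

/-- The shadow `δB = {B \ {i} : i ∈ B}` of a finite set `B`. -/
def shadowSet (B : Finset ℕ) : Finset (Finset ℕ) := B.image fun i => B.erase i

/-- `B` is a bad set of `ℬ ⊆ 𝒫(n)` if `δB ⊆ ℬ` or `d_ℬ(B) = B`. -/
def BadSet (n : ℕ) (ℬ : Finset (Finset ℕ)) (B : Finset ℕ) : Prop :=
  shadowSet B ⊆ ℬ ∨ DCompSet n ℬ B = B

/-- A family is a down-set if it is closed under taking subsets. -/
def IsDownSet (𝒟 : Finset (Finset ℕ)) : Prop := ∀ A ∈ 𝒟, ∀ B ⊆ A, B ∈ 𝒟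

/-- The deficiency `def(ℬ) = Σ_{B∈ℬ} |δB \ ℬ|`. -/
def deficiency (ℬ : Finset (Finset ℕ)) : ℕ := ∑ B ∈ ℬ, (shadowSet B \ ℬ).card

/-- `𝒜 ⊆ 𝒫(n)` is a counterexample to the union-closed conjecture:
union-closed, not `{∅}`, and every element of `[n]` has degree `< |𝒜|/2`. -/
def UCCounterexample (n : ℕ) (𝒜 : Finset (Finset ℕ)) : Prop :=
  𝒜 ⊆ (Finset.Icc 1 n).powerset ∧ UnionClosed 𝒜 ∧ 𝒜 ≠ {∅} ∧
    ∀ i ∈ Finset.Icc 1 n, ((𝒜.filter fun A => i ∈ A).card : ℚ) < (𝒜.card : ℚ) / 2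

theorem compressSet_subset (ℬ : Finset (Finset ℕ)) (i : ℕ) (B : Finset ℕ) :
    compressSet ℬ i B ⊆ B := by
  unfold compressSet
  split_ifs
  · exact erase_subset i B
  · exact Subset.rfl

theorem compressSet_eq_self {ℬ : Finset (Finset ℕ)} {i : ℕ} {B : Finset ℕ}
    (h : i ∈ B → B.erase i ∈ ℬ) : compressSet ℬ i B = B :=
  if_neg fun h' => h'.2 (h h'.1)

theorem compressSet_of_erase_notMem {ℬ : Finset (Finset ℕ)} {i : ℕ} {B : Finset ℕ}
    (hi : i ∈ B) (h : B.erase i ∉ ℬ) : compressSet ℬ i B = B.erase i :=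
  if_pos ⟨hi, h⟩

theorem of_compressSet_ne {ℬ : Finset (Finset ℕ)} {i : ℕ} {B : Finset ℕ}
    (h : compressSet ℬ i B ≠ B) : i ∈ B ∧ B.erase i ∉ ℬ := by
  by_contra h'
  exact h (if_neg h')

theorem erase_mem_of_compressSet_eq {ℬ : Finset (Finset ℕ)} {i : ℕ} {B : Finset ℕ}
    (h : compressSet ℬ i B = B) (hi : i ∈ B) : B.erase i ∈ ℬ := by
  by_contra hn
  rw [compressSet_of_erase_notMem hi hn] at h
  exact notMem_erase i B (h.symm ▸ hi)

/-- A set of `ℬ` fixed by the compression stays in the compressed family. -/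
theorem mem_dComp_of_mem {ℬ : Finset (Finset ℕ)} {i : ℕ} {B : Finset ℕ} (hB : B ∈ ℬ)
    (h : i ∈ B → B.erase i ∈ ℬ) : B ∈ dComp i ℬ :=
  mem_image.2 ⟨B, hB, compressSet_eq_self h⟩

theorem DCompSet_mem {ℬ : Finset (Finset ℕ)} {B : Finset ℕ} (hB : B ∈ ℬ) (k : ℕ) :
    DCompSet k ℬ B ∈ DComp k ℬ := by
  induction k with
  | zero => exact hB
  | succ k ih => exact mem_image_of_mem _ ih

theorem exists_DCompSet_eq {ℬ : Finset (Finset ℕ)} (k : ℕ) :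
    ∀ A ∈ DComp k ℬ, ∃ B ∈ ℬ, DCompSet k ℬ B = A := by
  induction k with
  | zero => exact fun A hA => ⟨A, hA, rfl⟩
  | succ k ih =>
    intro A hA
    obtain ⟨A', hA', rfl⟩ := mem_image.1 hA
    obtain ⟨B, hB, rfl⟩ := ih A' hA'
    exact ⟨B, hB, rfl⟩

theorem DCompSet_antitone (ℬ : Finset (Finset ℕ)) (B : Finset ℕ) :
    Antitone fun k => DCompSet k ℬ B :=
  antitone_nat_of_succ_le fun _ => compressSet_subset _ _ _

theorem DCompSet_eq_self_of_le {ℬ : Finset (Finset ℕ)} {B : Finset ℕ} {j k : ℕ} (hjk : j ≤ k)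
    (h : DCompSet k ℬ B = B) : DCompSet j ℬ B = B := by
  have h0 : DCompSet j ℬ B ⊆ B := DCompSet_antitone ℬ B (Nat.zero_le j)
  have h1 : DCompSet k ℬ B ⊆ DCompSet j ℬ B := DCompSet_antitone ℬ B hjk
  rw [h] at h1
  exact h0.antisymm h1

/-- A set moved by the first `k` compressions is moved for the first time at some step. -/
theorem exists_first_move {ℬ : Finset (Finset ℕ)} {B : Finset ℕ} {k : ℕ}
    (h : DCompSet k ℬ B ≠ B) :
    ∃ j < k, DCompSet j ℬ B = B ∧ j + 1 ∈ B ∧ B.erase (j + 1) ∉ DComp j ℬ := by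
  induction k with
  | zero => exact absurd rfl h
  | succ k ih =>
    by_cases hk : DCompSet k ℬ B = B
    · have h' : compressSet (DComp k ℬ) (k + 1) (DCompSet k ℬ B) ≠ B := h
      rw [hk] at h'
      exact ⟨k, k.lt_succ_self, hk, of_compressSet_ne h'⟩
    · obtain ⟨j, hj, hr⟩ := ih hk
      exact ⟨j, hj.trans k.lt_succ_self, hr⟩

/-- A cube `[{i}, B]` contained in `ℬ` is preserved by compressions in directions below `i`. -/
theorem RootedAt.dComp_of_lt {ℬ : Finset (Finset ℕ)} {B : Finset ℕ} {i : ℕ}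
    (h : RootedAt ℬ B i) {k : ℕ} (hk : k < i) : RootedAt (DComp k ℬ) B i := by
  induction k with
  | zero => exact h
  | succ k ih =>
    have ih := ih (Nat.lt_of_succ_lt hk)
    refine ⟨h.1, fun C hiC hCB => mem_dComp_of_mem (ih.2 C hiC hCB) fun _ => ?_⟩
    refine ih.2 _ ?_ ((erase_subset _ _).trans hCB)
    rw [singleton_subset_iff] at hiC ⊢
    exact mem_erase.2 ⟨hk.ne', hiC⟩

theorem RootedAt.of_erase {ℬ : Finset (Finset ℕ)} {B : Finset ℕ} {s j : ℕ}
    (hj : RootedAt ℬ B j) (hs : RootedAt ℬ (B.erase j) s) : RootedAt ℬ B s := by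
  refine ⟨mem_of_mem_erase hs.1, fun C hsC hCB => ?_⟩
  by_cases hjC : j ∈ C
  · exact hj.2 C (singleton_subset_iff.2 hjC) hCB
  · exact hs.2 C hsC (subset_erase.2 ⟨hCB, hjC⟩)

/-- If moved sets generate down-sets at stages below `k`, and `B \ T` is never moved for
`T ⊂ S`, then `B \ S` can be missing from `D_k(ℬ)` only when `B` is rooted in `S`. -/
theorem SimplyRooted.sdiff_mem_or_rootedAt {ℬ : Finset (Finset ℕ)} (hsr : SimplyRooted ℬ)
    (k : ℕ) (hdown : ∀ j < k, ∀ B ∈ ℬ, DCompSet j ℬ B ≠ B →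
      ∀ C ⊆ DCompSet j ℬ B, C ∈ DComp j ℬ)
    (B S : Finset ℕ) (hS : S.Nonempty) (hSB : S ⊆ B)
    (hfix : ∀ T ⊂ S, B \ T ∈ ℬ ∧ DCompSet k ℬ (B \ T) = B \ T) :
    B \ S ∈ DComp k ℬ ∨ ∃ s ∈ S, RootedAt ℬ B s := by
  induction k using Nat.strong_induction_on generalizing B S with
  | _ k ih =>
    have hB : B ∈ ℬ := by simpa using (hfix ∅ hS.empty_ssubset).1
    obtain ⟨c, hcB, hc⟩ := hsr B hB (hS.mono hSB)
    by_cases hcS : c ∈ S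
    · exact Or.inr ⟨c, hcS, hcB, hc⟩
    have hBS : B \ S ∈ ℬ :=
      hc _ (singleton_subset_iff.2 (mem_sdiff.2 ⟨hcB, hcS⟩)) sdiff_subset
    by_cases hmove : DCompSet k ℬ (B \ S) = B \ S
    · exact Or.inl (hmove ▸ DCompSet_mem hBS k)
    obtain ⟨j, hjk, hjfix, hjmem, hjnot⟩ := exists_first_move hmove
    obtain ⟨hjB, hjS⟩ := mem_sdiff.1 hjmem
    have hdown' : ∀ i < j, ∀ B ∈ ℬ, DCompSet i ℬ B ≠ B →
        ∀ C ⊆ DCompSet i ℬ B, C ∈ DComp i ℬ := fun i hi => hdown i (hi.trans hjk)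
    have herase : ∀ T ⊂ S, (B \ T).erase (j + 1) ∈ ℬ ∧
        DCompSet j ℬ ((B \ T).erase (j + 1)) = (B \ T).erase (j + 1) := by
      intro T hT
      have h1 := DCompSet_eq_self_of_le (Nat.succ_le_of_lt hjk) (hfix T hT).2
      have h2 : compressSet (DComp j ℬ) (j + 1) (DCompSet j ℬ (B \ T)) = B \ T := h1
      rw [DCompSet_eq_self_of_le hjk.le (hfix T hT).2] at h2
      obtain ⟨A, hA, hAeq⟩ := exists_DCompSet_eq j _ (erase_mem_of_compressSet_eq h2
        (mem_sdiff.2 ⟨hjB, fun h => hjS (hT.subset h)⟩))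
      by_cases hAA : DCompSet j ℬ A = A
      · rw [← hAeq, hAA]
        exact ⟨hA, hAA⟩
      · refine absurd (hdown j hjk A hA hAA _ ?_) hjnot
        rw [hAeq]
        exact erase_subset_erase _ (sdiff_subset_sdiff Subset.rfl hT.subset)
    have hsmall := ih j hjk hdown' (B.erase (j + 1)) S hS (subset_erase.2 ⟨hSB, hjS⟩)
      fun T hT => by rw [erase_sdiff_comm]; exact herase T hT
    rw [erase_sdiff_comm] at hsmall
    obtain ⟨s, hsS, hs⟩ := hsmall.resolve_left hjnot
    have hlarge := ih j hjk hdown' B (insert (j + 1) S) (insert_nonempty _ _)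
      (insert_subset hjB hSB) fun T hT => by
        by_cases hjT : j + 1 ∈ T
        · have hT' : T.erase (j + 1) ⊂ S := by
            refine ⟨subset_insert_iff.1 hT.subset, fun h => hT.2 ?_⟩
            exact insert_subset hjT (h.trans (erase_subset _ _))
          have h := herase _ hT'
          rwa [← sdiff_insert, insert_erase hjT] at h
        · have hTS : T ⊆ S := (subset_insert_iff_of_notMem hjT).1 hT.subset
          rcases hTS.eq_or_ssubset with rfl | hTS
          · exact ⟨hBS, hjfix⟩
          · exact ⟨(hfix T hTS).1, DCompSet_eq_self_of_le hjk.le (hfix T hTS).2⟩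
    rw [sdiff_insert] at hlarge
    obtain ⟨r, hr, hrB⟩ := hlarge.resolve_left hjnot
    rcases mem_insert.1 hr with rfl | hrS
    · exact Or.inr ⟨s, hsS, hrB.of_erase hs⟩
    · exact Or.inr ⟨r, hrS, hrB⟩

/-- Every subset of the image of a moved set lies in the compressed family. -/
theorem SimplyRooted.mem_DComp_of_subset {ℬ : Finset (Finset ℕ)} (hsr : SimplyRooted ℬ)
    (k : ℕ) : ∀ B ∈ ℬ, DCompSet k ℬ B ≠ B → ∀ C ⊆ DCompSet k ℬ B, C ∈ DComp k ℬ := by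
  induction k using Nat.strong_induction_on with
  | _ k ih =>
    cases k with
    | zero => exact fun B _ h => absurd rfl h
    | succ k =>
      intro B hB hne C hC
      by_cases hk : DCompSet k ℬ B = B
      · have hne' : compressSet (DComp k ℬ) (k + 1) (DCompSet k ℬ B) ≠ B := hne
        have hC' : C ⊆ compressSet (DComp k ℬ) (k + 1) (DCompSet k ℬ B) := hC
        rw [hk] at hne' hC'
        obtain ⟨hkB, hkn⟩ := of_compressSet_ne hne'
        rw [compressSet_of_erase_notMem hkB hkn] at hC'
        have hroot := hsr.sdiff_mem_or_rootedAt k (fun j hj => ih j (hj.trans k.lt_succ_self))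
          B {k + 1} (singleton_nonempty _) (singleton_subset_iff.2 hkB) fun T hT => by
            rw [ssubset_singleton_iff.1 hT, sdiff_empty]
            exact ⟨hB, hk⟩
        rw [sdiff_singleton_eq_erase] at hroot
        obtain ⟨s, hs, hsB⟩ := hroot.resolve_left hkn
        obtain rfl := mem_singleton.1 hs
        have hcube := hsB.dComp_of_lt k.lt_succ_self
        obtain ⟨hCB, hkC⟩ := subset_erase.1 hC'
        by_cases hCk : C ∈ DComp k ℬ
        · exact mem_dComp_of_mem hCk fun h => absurd h hkC
        · refine mem_image.2 ⟨insert (k + 1) C, hcube.2 _ (by simp) (insert_subset hkB hCB), ?_⟩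
          have he : (insert (k + 1) C).erase (k + 1) = C := erase_insert hkC
          rw [compressSet_of_erase_notMem (mem_insert_self _ _) (he.symm ▸ hCk), he]
      · have hd := ih k k.lt_succ_self B hB hk
        have hC' := hC.trans (compressSet_subset _ _ _)
        exact mem_dComp_of_mem (hd C hC') fun _ => hd _ ((erase_subset _ _).trans hC')

/-- The compressions remove at most one element of each set of a simply rooted family. -/
theorem SimplyRooted.DCompSet_eq_self_or_erase {ℬ : Finset (Finset ℕ)} (hsr : SimplyRooted ℬ)
    {B : Finset ℕ} (hB : B ∈ ℬ) (k : ℕ) :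
    DCompSet k ℬ B = B ∨ ∃ i, DCompSet k ℬ B = B.erase i := by
  induction k with
  | zero => exact Or.inl rfl
  | succ k ih =>
    by_cases hk : DCompSet k ℬ B = B
    · change compressSet _ _ (DCompSet k ℬ B) = B ∨
        ∃ i, compressSet _ _ (DCompSet k ℬ B) = B.erase i
      rw [hk]
      unfold compressSet
      split_ifs
      · exact Or.inr ⟨_, rfl⟩
      · exact Or.inl rfl
    · have h : DCompSet (k + 1) ℬ B = DCompSet k ℬ B :=
        compressSet_eq_self fun _ => hsr.mem_DComp_of_subset k B hB hk _ (erase_subset _ _)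
      rwa [h]

/-- For a simply rooted family `ℬ ⊆ 𝒫(n)`: (1) for `B ∈ ℬ` and
`1 ≤ k ≤ n`, if `D_{(ℬ,k)}(B) ≠ B` then every subset of `D_{(ℬ,k)}(B)` is in
`D_k(ℬ)`; (2) for `B ∈ ℬ`, `|B \ d_ℬ(B)| ≤ 1`. -/
theorem stmt9 (n : ℕ) (ℬ : Finset (Finset ℕ)) (hsub : ℬ ⊆ (Finset.Icc 1 n).powerset)
    (hsr : SimplyRooted ℬ) :
    (∀ B ∈ ℬ, ∀ k, 1 ≤ k → k ≤ n → DCompSet k ℬ B ≠ B →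
      ∀ C ⊆ DCompSet k ℬ B, C ∈ DComp k ℬ) ∧
    (∀ B ∈ ℬ, (B \ DCompSet n ℬ B).card ≤ 1) := by
  refine ⟨fun B hB k _ _ => hsr.mem_DComp_of_subset k B hB, fun B hB => ?_⟩
  rcases hsr.DCompSet_eq_self_or_erase hB n with h | ⟨i, h⟩
  · simp [h]
  · rw [h, card_le_one]
    intro a ha b hb
    simp only [mem_sdiff, mem_erase, not_and_or, not_not] at ha hb
    rw [ha.2.resolve_right (not_not.2 ha.1), hb.2.resolve_right (not_not.2 hb.1)]
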